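/- For two homogeneous hidden Markov models θ₁, θ₀ of length N ≥ 2 with all parameters strictly positive and a fixed evidence sequence x : Fin N → 𝒳, the Kullback–Leibler distance between the posterior distributions of the hidden sequence satisfies D( P_{θ₁}(S|E) ‖ P_{θ₀}(S|E) ) := Σ_{s : Fin N → 𝒮} P_{θ₁}(s|E) log( P_{θ₁}(s|E) / P_{θ₀}(s|E) ) = Σ_{s∈𝒮} P_{θ₁}(S_0 = s | E) · [ log( P_{θ₁}(S_0 = s | E) / P_{θ₀}(S_0 = s | E) ) + K^E_0(s) ]. -/

import Mathlib

/-!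
STATEMENT 11: The KLD between the posterior distributions of the hidden sequences of two HMMs given the evidence `X = x`.
-/

namespace HMMev

variable {𝒮 𝒳 : Type} [Fintype 𝒮] [Fintype 𝒳]

/-- The joint pmf `p_θ(x, s)` of a homogeneous hidden Markov model of length `N`:
`p_θ(x,s) = μ_θ(s 0) e_θ(s 0, x 0) · ∏_{i=1}^{N-1} π_θ(s(i-1), s i) e_θ(s i, x i)`. -/
noncomputable def pmf (N : ℕ) (hN : 2 ≤ N) (μ : 𝒮 → ℝ) (π : 𝒮 → 𝒮 → ℝ) (e : 𝒮 → 𝒳 → ℝ)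
    (x : Fin N → 𝒳) (s : Fin N → 𝒮) : ℝ :=
  μ (s ⟨0, by omega⟩) * e (s ⟨0, by omega⟩) (x ⟨0, by omega⟩) *
    ∏ i : Fin N,
      if i.val = 0 then 1
      else π (s ⟨i.val - 1, Nat.lt_of_le_of_lt (Nat.sub_le _ _) i.isLt⟩) (s i) * e (s i) (x i)

/-- Given the weights `w_θ(t) = p_θ(x, t)` for a fixed evidence `x`, the conditional
probability `P_θ(S_i = s | S_{i-1} = r, E)`. -/
noncomputable def condTrans {N : ℕ} [DecidableEq 𝒮] (w : (Fin N → 𝒮) → ℝ) (i : Fin N)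
    (r s : 𝒮) : ℝ :=
  (∑ t ∈ Finset.univ.filter (fun t : Fin N → 𝒮 =>
      t ⟨i.val - 1, Nat.lt_of_le_of_lt (Nat.sub_le _ _) i.isLt⟩ = r ∧ t i = s), w t) /
  (∑ t ∈ Finset.univ.filter (fun t : Fin N → 𝒮 =>
      t ⟨i.val - 1, Nat.lt_of_le_of_lt (Nat.sub_le _ _) i.isLt⟩ = r), w t)

/-- Given the weights `w_θ(t) = p_θ(x, t)` for a fixed evidence `x`, the conditional tail pmf
`Q^i_θ(τ | s)` of the hidden states strictly after position `i`, given `S_i = s`. -/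
noncomputable def condTail {N : ℕ} [DecidableEq 𝒮] (w : (Fin N → 𝒮) → ℝ) (i : Fin N) (s : 𝒮)
    (τ : {j : Fin N // i < j} → 𝒮) : ℝ :=
  (∑ t ∈ Finset.univ.filter (fun t : Fin N → 𝒮 =>
      t i = s ∧ ∀ j : {j : Fin N // i < j}, t j.val = τ j), w t) /
  (∑ t ∈ Finset.univ.filter (fun t : Fin N → 𝒮 => t i = s), w t)

/-- The conditional inward quantity `K^E_i(s)`: the Kullback–Leibler distance between the
conditional tail pmfs under `θ₁` (weights `w1`) and `θ₀` (weights `w0`). -/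
noncomputable def KE {N : ℕ} [DecidableEq 𝒮] (w1 w0 : (Fin N → 𝒮) → ℝ) (i : Fin N)
    (s : 𝒮) : ℝ :=
  ∑ τ : {j : Fin N // i < j} → 𝒮,
    condTail w1 i s τ * Real.log (condTail w1 i s τ / condTail w0 i s τ)

/-- The posterior pmf `P_θ(s | E) = w_θ(s) / Σ_{s'} w_θ(s')` of the whole hidden sequence. -/
noncomputable def post {N : ℕ} (w : (Fin N → 𝒮) → ℝ) (t : Fin N → 𝒮) : ℝ :=
  w t / ∑ t' : Fin N → 𝒮, w t'

/-- The posterior `P_θ(S_i = s | E)` of the hidden state at position `i`. -/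
noncomputable def postAt {N : ℕ} [DecidableEq 𝒮] (w : (Fin N → 𝒮) → ℝ) (i : Fin N)
    (s : 𝒮) : ℝ :=
  (∑ t ∈ Finset.univ.filter (fun t : Fin N → 𝒮 => t i = s), w t) /
  (∑ t : Fin N → 𝒮, w t)

end HMMev

namespace HMMev

lemma pmf_pos {𝒮 𝒳 : Type} {N : ℕ} (hN : 2 ≤ N) {μ : 𝒮 → ℝ} {π : 𝒮 → 𝒮 → ℝ} {e : 𝒮 → 𝒳 → ℝ}
    (hμ : ∀ s, 0 < μ s) (hπ : ∀ r s, 0 < π r s) (he : ∀ s x, 0 < e s x)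
    (x : Fin N → 𝒳) (t : Fin N → 𝒮) : 0 < pmf N hN μ π e x t := by
  unfold pmf
  refine mul_pos (mul_pos (hμ _) (he _ _)) (Finset.prod_pos fun i _ => ?_)
  split_ifs
  · exact one_pos
  · exact mul_pos (hπ _ _) (he _ _)

/-- A sequence is the same as its entry at the least index together with its tail. -/
def headTailEquiv (𝒮 : Type) {N : ℕ} (i : Fin N) (hi : ∀ j, i ≤ j) :
    (Fin N → 𝒮) ≃ 𝒮 × ({j : Fin N // i < j} → 𝒮) where
  toFun t := (t i, fun j => t j)
  invFun p := fun j => if h : i < j then p.2 ⟨j, h⟩ else p.1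
  left_inv t := by
    funext j
    by_cases h : i < j
    · simp [h]
    · simp [le_antisymm (not_lt.mp h) (hi j)]
  right_inv p := by
    ext j
    · simp
    · simp [j.2]

section ChainRule

variable {𝒮 : Type} [Fintype 𝒮] [DecidableEq 𝒮] {N : ℕ} {i : Fin N}

lemma sum_filter_eq_sum_tail (hi : ∀ j, i ≤ j) (w : (Fin N → 𝒮) → ℝ) (s : 𝒮) :
    ∑ t ∈ Finset.univ.filter (fun t : Fin N → 𝒮 => t i = s), w t =
      ∑ τ, w ((headTailEquiv 𝒮 i hi).symm (s, τ)) := by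
  rw [Finset.sum_filter, ← (headTailEquiv 𝒮 i hi).symm.sum_comp, Fintype.sum_prod_type]
  have h : ∀ p, (headTailEquiv 𝒮 i hi).symm p i = p.1 := fun p =>
    congrArg Prod.fst ((headTailEquiv 𝒮 i hi).apply_symm_apply p)
  simp only [h]
  rw [Finset.sum_eq_single s]
  · simp
  · intro b _ hb
    simp [hb]
  · simp

lemma condTail_eq (hi : ∀ j, i ≤ j) (w : (Fin N → 𝒮) → ℝ) (s : 𝒮)
    (τ : {j : Fin N // i < j} → 𝒮) :
    condTail w i s τ = w ((headTailEquiv 𝒮 i hi).symm (s, τ)) /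
      ∑ t ∈ Finset.univ.filter (fun t : Fin N → 𝒮 => t i = s), w t := by
  have h : Finset.univ.filter (fun t : Fin N → 𝒮 =>
      t i = s ∧ ∀ j : {j : Fin N // i < j}, t j.val = τ j) =
      {(headTailEquiv 𝒮 i hi).symm (s, τ)} := by
    ext t
    rw [Finset.mem_filter, Finset.mem_singleton, Equiv.eq_symm_apply, Prod.ext_iff,
      funext_iff]
    simp [headTailEquiv]
  rw [condTail, h, Finset.sum_singleton]

/-- Chain rule for the Kullback–Leibler distance between the normalizations of two positive
weights, splitting off the state at the least index. -/
lemma kld_post_eq (hi : ∀ j, i ≤ j) {w₁ w₀ : (Fin N → 𝒮) → ℝ}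
    (h₁ : ∀ t, 0 < w₁ t) (h₀ : ∀ t, 0 < w₀ t) :
    ∑ t, post w₁ t * Real.log (post w₁ t / post w₀ t) =
      ∑ s, postAt w₁ i s * (Real.log (postAt w₁ i s / postAt w₀ i s) + KE w₁ w₀ i s) := by
  have marg_pos : ∀ w : (Fin N → 𝒮) → ℝ, (∀ t, 0 < w t) → ∀ s,
      0 < ∑ t ∈ Finset.univ.filter (fun t : Fin N → 𝒮 => t i = s), w t := fun w hw s =>
    Finset.sum_pos (fun t _ => hw t) ⟨fun _ => s, by simp⟩
  have total_pos : ∀ w : (Fin N → 𝒮) → ℝ, (∀ t, 0 < w t) → 𝒮 → 0 < ∑ t, w t := fun w hw s =>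
    Finset.sum_pos (fun t _ => hw t) ⟨fun _ => s, Finset.mem_univ _⟩
  have postAt_pos : ∀ w : (Fin N → 𝒮) → ℝ, (∀ t, 0 < w t) → ∀ s, 0 < postAt w i s :=
    fun w hw s => div_pos (marg_pos w hw s) (total_pos w hw s)
  have condTail_pos : ∀ w : (Fin N → 𝒮) → ℝ, (∀ t, 0 < w t) → ∀ s τ, 0 < condTail w i s τ :=
    fun w hw s τ => condTail_eq hi w s τ ▸ div_pos (hw _) (marg_pos w hw s)
  have factor : ∀ w : (Fin N → 𝒮) → ℝ, (∀ t, 0 < w t) → ∀ s τ,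
      post w ((headTailEquiv 𝒮 i hi).symm (s, τ)) = postAt w i s * condTail w i s τ := by
    intro w hw s τ
    have := (marg_pos w hw s).ne'
    rw [condTail_eq hi, post, postAt]
    field_simp
  have sum_condTail : ∀ s, ∑ τ, condTail w₁ i s τ = 1 := by
    intro s
    simp only [condTail_eq hi]
    rw [← Finset.sum_div, ← sum_filter_eq_sum_tail hi, div_self (marg_pos w₁ h₁ s).ne']
  rw [← (headTailEquiv 𝒮 i hi).symm.sum_comp, Fintype.sum_prod_type]
  refine Finset.sum_congr rfl fun s _ => ?_
  calc
    _ = ∑ τ, (postAt w₁ i s * Real.log (postAt w₁ i s / postAt w₀ i s) * condTail w₁ i s τ +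
          postAt w₁ i s *
            (condTail w₁ i s τ * Real.log (condTail w₁ i s τ / condTail w₀ i s τ))) := by
      refine Finset.sum_congr rfl fun τ _ => ?_
      rw [factor w₁ h₁, factor w₀ h₀, mul_div_mul_comm,
        Real.log_mul (div_pos (postAt_pos w₁ h₁ s) (postAt_pos w₀ h₀ s)).ne'
          (div_pos (condTail_pos w₁ h₁ s τ) (condTail_pos w₀ h₀ s τ)).ne']
      ring
    _ = _ := by
      rw [Finset.sum_add_distrib, ← Finset.mul_sum, ← Finset.mul_sum, sum_condTail, KE]
      ring

end ChainRule

end HMMev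

open HMMev in
theorem hmm_evidence_kld
    (𝒮 𝒳 : Type) [Fintype 𝒮] [Fintype 𝒳] [Nonempty 𝒮] [Nonempty 𝒳] [DecidableEq 𝒮]
    (N : ℕ) (hN : 2 ≤ N)
    (μ1 μ0 : 𝒮 → ℝ) (π1 π0 : 𝒮 → 𝒮 → ℝ) (e1 e0 : 𝒮 → 𝒳 → ℝ)
    (hμ1pos : ∀ s, 0 < μ1 s) (hμ1sum : ∑ s, μ1 s = 1)
    (hμ0pos : ∀ s, 0 < μ0 s) (hμ0sum : ∑ s, μ0 s = 1)
    (hπ1pos : ∀ r s, 0 < π1 r s) (hπ1sum : ∀ r, ∑ s, π1 r s = 1)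
    (hπ0pos : ∀ r s, 0 < π0 r s) (hπ0sum : ∀ r, ∑ s, π0 r s = 1)
    (he1pos : ∀ s x, 0 < e1 s x) (he1sum : ∀ s, ∑ x, e1 s x = 1)
    (he0pos : ∀ s x, 0 < e0 s x) (he0sum : ∀ s, ∑ x, e0 s x = 1)
    (x : Fin N → 𝒳) :
    ∑ t : Fin N → 𝒮,
        post (pmf N hN μ1 π1 e1 x) t *
          Real.log (post (pmf N hN μ1 π1 e1 x) t / post (pmf N hN μ0 π0 e0 x) t) =
      ∑ s : 𝒮,
        postAt (pmf N hN μ1 π1 e1 x) ⟨0, by omega⟩ s *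
          (Real.log (postAt (pmf N hN μ1 π1 e1 x) ⟨0, by omega⟩ s /
              postAt (pmf N hN μ0 π0 e0 x) ⟨0, by omega⟩ s) +
            KE (pmf N hN μ1 π1 e1 x) (pmf N hN μ0 π0 e0 x) ⟨0, by omega⟩ s) := by
  exact kld_post_eq (fun j => Fin.le_def.mpr (Nat.zero_le j.val))
    (pmf_pos hN hμ1pos hπ1pos he1pos x) (pmf_pos hN hμ0pos hπ0pos he0pos x)
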